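/- arXiv:2412.20775 — 4 statements merged into one kernel-verified Lean document; each statement's English description precedes it below -/
import Mathlib

section
/- Let p, q ≥ 1 and let G be a finite simple graph whose adjacency matrix has the same characteristic polynomial (over ℝ) as that of the complete bipartite graph K_{p,q}. Then there exist natural numbers a, b ≥ 1 with a·b = p·q such that the subgraph of G induced on the set of its non-isolated vertices is isomorphic to K_{a,b}; i.e., G is a disjoint union of one complete bipartite graph K_{a,b} with a·b = p·q and isolated vertices. -/
open Polynomial

instance completeBipartiteGraph.decidableRelAdj {V W : Type*} :
    DecidableRel (completeBipartiteGraph V W).Adj := fun v w => by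
  cases v <;> cases w <;> simp [completeBipartiteGraph] <;> infer_instance

theorem cbip_key {V : Type} [Fintype V] [DecidableEq V] {A : Matrix V V ℝ} (hA : A.IsHermitian)
    (c : ℝ) : A ^ 3 = c • A ↔ ∀ i, hA.eigenvalues i ^ 3 = c * hA.eigenvalues i := by
  have h := hA.spectral_theorem
  set φ := Unitary.conjStarAlgAut ℝ _ hA.eigenvectorUnitary
  set D : Matrix V V ℝ := Matrix.diagonal (RCLike.ofReal ∘ hA.eigenvalues) with hD
  have h1 : A ^ 3 = c • A ↔ D ^ 3 = c • D := by
    constructor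
    · intro h2
      apply EquivLike.injective φ
      rw [map_pow, map_smul, ← h, h2]
    · intro h2
      rw [h, ← map_pow, ← map_smul, h2]
  rw [h1, hD, Matrix.diagonal_pow, ← Matrix.diagonal_smul, Matrix.diagonal_eq_diagonal_iff]
  simp

theorem cbip_trace {V : Type} [Fintype V] [DecidableEq V] {A : Matrix V V ℝ} (hA : A.IsHermitian) :
    (A ^ 2).trace = (A.charpoly.roots.map (fun x => x ^ 2)).sum := by
  have h := hA.spectral_theorem
  rw [hA.roots_charpoly_eq_eigenvalues, Multiset.map_map]
  conv_lhs => rw [h]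
  rw [← map_pow, Unitary.conjStarAlgAut_apply, Matrix.trace_mul_comm, ← mul_assoc]
  simp [Matrix.diagonal_pow, Matrix.trace]

theorem cbip_transfer {V W : Type} [Fintype V] [DecidableEq V] [Fintype W] [DecidableEq W]
    {A : Matrix V V ℝ} {B : Matrix W W ℝ} (hA : A.IsHermitian) (hB : B.IsHermitian)
    (h : A.charpoly = B.charpoly) (c : ℝ) (hc : B ^ 3 = c • B) : A ^ 3 = c • A := by
  rw [cbip_key hB] at hc
  rw [cbip_key hA]
  intro i
  have h1 := hA.roots_charpoly_eq_eigenvalues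
  have h2 := hB.roots_charpoly_eq_eigenvalues
  rw [h, h2] at h1
  have : hA.eigenvalues i ∈ Multiset.map ((RCLike.ofReal : ℝ → ℝ) ∘ hA.eigenvalues) Finset.univ.val :=
    Multiset.mem_map.2 ⟨i, by simp, by simp⟩
  rw [← h1] at this
  obtain ⟨j, -, hj⟩ := Multiset.mem_map.1 this
  rw [← hj]
  simpa using hc j

theorem cbip_K (p q : ℕ) :
    ((completeBipartiteGraph (Fin p) (Fin q)).adjMatrix ℝ) ^ 3 =
      ((p * q : ℕ) : ℝ) • ((completeBipartiteGraph (Fin p) (Fin q)).adjMatrix ℝ) ∧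
    (((completeBipartiteGraph (Fin p) (Fin q)).adjMatrix ℝ) ^ 2).trace = 2 * ((p * q : ℕ) : ℝ) := by
  constructor
  · ext i j
    rw [pow_succ, pow_two, Matrix.mul_apply]
    rcases i with i | i <;> rcases j with j | j <;>
      simp [Matrix.mul_apply, SimpleGraph.adjMatrix_apply] <;> ring
  · rw [pow_two, Matrix.trace]
    simp [Matrix.mul_apply, SimpleGraph.adjMatrix_apply]
    ring

set_option maxHeartbeats 1000000 in
theorem cbip_comb (c : ℕ) (hc : 1 ≤ c)
    {V : Type} [Fintype V] [DecidableEq V] (G : SimpleGraph V) [DecidableRel G.Adj]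
    (h3 : (G.adjMatrix ℝ) ^ 3 = (c : ℝ) • G.adjMatrix ℝ)
    (h2 : ((G.adjMatrix ℝ) ^ 2).trace = 2 * (c : ℝ)) :
    ∃ a b : ℕ, 1 ≤ a ∧ 1 ≤ b ∧ a * b = c ∧
      Nonempty ((G.induce {v : V | ∃ w, G.Adj v w}) ≃g
        completeBipartiteGraph (Fin a) (Fin b)) := by
  have e3 : ∀ u v, ∑ x, ∑ y, (if G.Adj u x ∧ G.Adj x y ∧ G.Adj y v then (1:ℝ) else 0)
      = if G.Adj u v then (c : ℝ) else 0 := by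
    intro u v
    have := congrFun (congrFun h3 u) v
    rw [pow_succ', pow_two, Matrix.mul_apply] at this
    simp only [Matrix.mul_apply, Matrix.smul_apply, SimpleGraph.adjMatrix_apply, smul_eq_mul,
      mul_ite, mul_one, mul_zero, Finset.mul_sum] at this
    rw [← this]
    refine Finset.sum_congr rfl fun x _ => Finset.sum_congr rfl fun y _ => ?_
    split_ifs <;> simp_all
  have e2 : ∑ x, ∑ y, (if G.Adj x y then (1:ℝ) else 0) = 2 * c := by
    rw [← h2, pow_two, Matrix.trace]
    simp only [Matrix.diag, Matrix.mul_apply, SimpleGraph.adjMatrix_apply]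
    refine Finset.sum_congr rfl fun x _ => Finset.sum_congr rfl fun y _ => ?_
    simp [G.adj_comm y x]
  have tri : ∀ u x y, G.Adj u x → G.Adj x y → G.Adj y u → False := by
    intro u x y h1 h2 h3
    have := e3 u u
    rw [if_neg (G.loopless.irrefl u)] at this
    rw [Finset.sum_eq_zero_iff_of_nonneg (fun _ _ => Finset.sum_nonneg fun _ _ => by positivity)] at this
    have := this x (Finset.mem_univ _)
    rw [Finset.sum_eq_zero_iff_of_nonneg (fun _ _ => by positivity)] at this
    have := this y (Finset.mem_univ _)
    simp [h1, h2, h3] at this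
  have key : ∀ u v x y, G.Adj u v → G.Adj x y →
      (G.Adj u x ∧ G.Adj y v) ∨ (G.Adj u y ∧ G.Adj x v) := by
    intro u v x y huv hxy
    have s1 := e3 u v
    have s2 := e3 u v
    rw [if_pos huv] at s1 s2
    rw [Finset.sum_comm] at s2
    have hle : ∀ z ∈ (Finset.univ : Finset (V × V)),
        (if G.Adj u z.1 ∧ G.Adj z.1 z.2 ∧ G.Adj z.2 v then (1:ℝ) else 0) +
        (if G.Adj u z.2 ∧ G.Adj z.2 z.1 ∧ G.Adj z.1 v then (1:ℝ) else 0) ≤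
        (if G.Adj z.1 z.2 then (1:ℝ) else 0) := by
      rintro ⟨x, y⟩ -
      have := tri u x v
      have := G.adj_comm x y
      have := G.adj_comm u v
      dsimp only
      split_ifs <;> simp_all
    have heq := (Finset.sum_eq_sum_iff_of_le hle).1 (by
      rw [Finset.sum_add_distrib, Fintype.sum_prod_type, Fintype.sum_prod_type,
        Fintype.sum_prod_type]
      dsimp only
      rw [s1, s2, e2]; ring) (x, y) (Finset.mem_univ _)
    by_contra hcon
    push Not at hcon
    simp only [if_pos hxy] at heq
    rw [if_neg (fun h => hcon.1 h.1 h.2.2), if_neg (fun h => hcon.2 h.1 h.2.2)] at heq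
    norm_num at heq
  obtain ⟨u, v, huv⟩ : ∃ u v, G.Adj u v := by
    by_contra hcon
    push Not at hcon
    simp [hcon] at e2
    omega
  have comp : ∀ x y, G.Adj u x → G.Adj v y → G.Adj x y := by
    intro x y hx hy
    rcases key u x v y hx hy with h | h
    · exact h.2.symm
    · exact (tri u v x huv h.2 hx.symm).elim
  have cover : ∀ x y, G.Adj x y → G.Adj u x ∨ G.Adj v x := by
    intro x y hxy
    rcases key u v x y huv hxy with h | h
    · exact Or.inl h.1
    · exact Or.inr h.2.symm
  have nU : ∀ x y, G.Adj u x → G.Adj u y → ¬ G.Adj x y := fun x y hx hy h =>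
    tri u x y hx h hy.symm
  have nV : ∀ x y, G.Adj v x → G.Adj v y → ¬ G.Adj x y := fun x y hx hy h =>
    tri v x y hx h hy.symm
  have nUV : ∀ x, G.Adj u x → ¬ G.Adj v x := fun x hx hy => tri u v x huv hy hx.symm
  refine ⟨G.degree u, G.degree v, ?_, ?_, ?_, ?_⟩
  · exact (G.degree_pos_iff_exists_adj u).2 ⟨v, huv⟩
  · exact (G.degree_pos_iff_exists_adj v).2 ⟨u, huv.symm⟩
  · have s1 := e3 u v
    rw [if_pos huv] at s1
    have : ∀ x y, (if G.Adj u x ∧ G.Adj x y ∧ G.Adj y v then (1:ℝ) else 0) =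
      (if G.Adj u x then (1:ℝ) else 0) * (if G.Adj v y then (1:ℝ) else 0) := by
      intro x y
      by_cases hx : G.Adj u x
      · by_cases hy : G.Adj v y
        · rw [if_pos ⟨hx, comp x y hx hy, hy.symm⟩, if_pos hx, if_pos hy, one_mul]
        · rw [if_neg (fun h => hy h.2.2.symm), if_neg hy, mul_zero]
      · rw [if_neg (fun h => hx h.1), if_neg hx, zero_mul]
    simp only [this] at s1
    rw [← Finset.sum_mul_sum, Finset.sum_boole, Finset.sum_boole, ← G.neighborFinset_eq_filter,
      ← G.neighborFinset_eq_filter, G.card_neighborFinset_eq_degree,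
      G.card_neighborFinset_eq_degree] at s1
    exact_mod_cast s1
  · let eU : {x // G.Adj u x} ≃ Fin (G.degree u) :=
      Fintype.equivFinOfCardEq (G.card_neighborSet_eq_degree u)
    let eV : {x // G.Adj v x} ≃ Fin (G.degree v) :=
      Fintype.equivFinOfCardEq (G.card_neighborSet_eq_degree v)
    let f : {x // G.Adj u x} ⊕ {x // G.Adj v x} → {x : V | ∃ w, G.Adj x w} :=
      Sum.elim (fun x => ⟨x.1, u, x.2.symm⟩) (fun x => ⟨x.1, v, x.2.symm⟩)
    have hf : Function.Bijective f := by
      constructor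
      · rintro (⟨x, hx⟩ | ⟨x, hx⟩) (⟨y, hy⟩ | ⟨y, hy⟩) hxy
        · simpa [f] using hxy
        · have : x = y := by simpa [f] using hxy
          subst this
          exact (nUV x hx hy).elim
        · have : x = y := by simpa [f] using hxy
          subst this
          exact (nUV x hy hx).elim
        · simpa [f] using hxy
      · rintro ⟨x, w, hxw⟩
        rcases cover x w hxw with h | h
        · exact ⟨Sum.inl ⟨x, h⟩, rfl⟩
        · exact ⟨Sum.inr ⟨x, h⟩, rfl⟩
    let F : completeBipartiteGraph {x // G.Adj u x} {x // G.Adj v x} ≃g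
        G.induce {x : V | ∃ w, G.Adj x w} :=
      { Equiv.ofBijective f hf with
        map_rel_iff' := by
          rintro (⟨x, hx⟩ | ⟨x, hx⟩) (⟨y, hy⟩ | ⟨y, hy⟩)
          · simpa [f] using nU x y hx hy
          · simpa [f] using comp x y hx hy
          · simpa [f] using (comp y x hy hx).symm
          · simpa [f] using nV x y hx hy }
    let E : completeBipartiteGraph {x // G.Adj u x} {x // G.Adj v x} ≃g
        completeBipartiteGraph (Fin (G.degree u)) (Fin (G.degree v)) :=
      { Equiv.sumCongr eU eV with
        map_rel_iff' := by
          rintro (x | x) (y | y) <;> simp }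
    exact ⟨F.symm.trans E⟩

/-- If a finite simple graph `G` is `A`-cospectral with the complete bipartite graph
`K_{p,q}`, then the subgraph of `G` induced on its non-isolated vertices is isomorphic
to a complete bipartite graph `K_{a,b}` with `a * b = p * q`; i.e., `G` is a disjoint
union of `K_{a,b}` and isolated vertices. -/
theorem cospectral_completeBipartiteGraph_structure (p q : ℕ) (hp : 1 ≤ p) (hq : 1 ≤ q)
    {V : Type} [Fintype V] [DecidableEq V] (G : SimpleGraph V) [DecidableRel G.Adj]
    (h : (G.adjMatrix ℝ).charpoly =
      ((completeBipartiteGraph (Fin p) (Fin q)).adjMatrix ℝ).charpoly) :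
    ∃ a b : ℕ, 1 ≤ a ∧ 1 ≤ b ∧ a * b = p * q ∧
      Nonempty ((G.induce {v : V | ∃ w, G.Adj v w}) ≃g
        completeBipartiteGraph (Fin a) (Fin b)) := by
  have hA := G.isSymm_adjMatrix (α := ℝ)
  have hB := (completeBipartiteGraph (Fin p) (Fin q)).isSymm_adjMatrix (α := ℝ)
  have hA : (G.adjMatrix ℝ).IsHermitian := by
    rwa [Matrix.IsHermitian, Matrix.conjTranspose_eq_transpose_of_trivial]
  have hB : ((completeBipartiteGraph (Fin p) (Fin q)).adjMatrix ℝ).IsHermitian := by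
    rwa [Matrix.IsHermitian, Matrix.conjTranspose_eq_transpose_of_trivial]
  obtain ⟨k3, k2⟩ := cbip_K p q
  refine cbip_comb (p * q) (Nat.mul_pos hp hq) G (cbip_transfer hA hB h _ k3) ?_
  rw [cbip_trace hA, h, ← cbip_trace hB, k2]
end

section
/- Let p, q ≥ 1 be natural numbers. The complete bipartite graph K_{p,q} is determined by its adjacency spectrum if and only if {p,q} is an AM-minimizer, i.e., if and only if for all natural numbers a, b ≥ 1 with a·b = p·q one has p + q ≤ a + b. -/
open Polynomial

theorem aux_spec {V : Type} [Fintype V] [DecidableEq V] (A : Matrix V V ℝ)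
    (hA : A.IsHermitian) (k : ℕ) (m : ℝ) (hm : 0 ≤ m)
    (h : A.charpoly = X ^ k * (X ^ 2 - C m)) :
    A * A * A = m • A ∧ (A * A).trace = 2 * m := by
  have hroots : A.charpoly.roots = Multiset.map hA.eigenvalues Finset.univ.val := by
    simpa using hA.roots_charpoly_eq_eigenvalues
  have hfac : A.charpoly = X ^ k * ((X - C (Real.sqrt m)) * (X - C (-Real.sqrt m))) := by
    rw [h]
    congr 1
    have : (C m : ℝ[X]) = C (Real.sqrt m) * C (Real.sqrt m) := by
      rw [← C_mul, Real.mul_self_sqrt hm]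
    rw [this, C_neg]
    ring
  have hr2 : A.charpoly.roots =
      k • {0} + ({Real.sqrt m} + {-Real.sqrt m}) := by
    rw [hfac, roots_mul, roots_mul, roots_X_pow, roots_X_sub_C, roots_X_sub_C]
    · exact mul_ne_zero (X_sub_C_ne_zero _) (X_sub_C_ne_zero _)
    · exact mul_ne_zero (pow_ne_zero _ X_ne_zero)
        (mul_ne_zero (X_sub_C_ne_zero _) (X_sub_C_ne_zero _))
  have hev : ∀ i, hA.eigenvalues i * hA.eigenvalues i * hA.eigenvalues i
      = m * hA.eigenvalues i := by
    intro i
    have hmem : hA.eigenvalues i ∈ A.charpoly.roots := by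
      rw [hroots]
      exact Multiset.mem_map_of_mem _ (Finset.mem_univ_val i)
    have hroot := (mem_roots'.1 hmem).2
    rw [IsRoot.def, h] at hroot
    simp only [eval_mul, eval_pow, eval_X, eval_sub, eval_C, mul_eq_zero] at hroot
    rcases hroot with h0 | h0
    · have := eq_zero_of_pow_eq_zero h0
      simp [this]
    · linear_combination (hA.eigenvalues i) * h0
  have hsum : ∑ i, hA.eigenvalues i * hA.eigenvalues i = 2 * m := by
    have h1 : (A.charpoly.roots.map (fun x => x * x)).sum = 2 * m := by
      rw [hr2]
      simp [Multiset.map_nsmul, Multiset.sum_nsmul, Real.mul_self_sqrt hm]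
      ring
    rw [hroots, Multiset.map_map] at h1
    exact h1
  have hs := hA.spectral_theorem
  set D : Matrix V V ℝ := Matrix.diagonal (RCLike.ofReal ∘ hA.eigenvalues) with hD
  set φ := Unitary.conjStarAlgAut ℝ (Matrix V V ℝ) hA.eigenvectorUnitary with hφ
  constructor
  · have : D * D * D = m • D := by
      rw [hD, Matrix.diagonal_mul_diagonal, Matrix.diagonal_mul_diagonal, ← Matrix.diagonal_smul]
      congr 1
      funext i
      simpa using hev i
    rw [hs, ← map_mul, ← map_mul, this, map_smul]
  · have : (D * D).trace = 2 * m := by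
      rw [hD, Matrix.diagonal_mul_diagonal, Matrix.trace_diagonal]
      simpa using hsum
    rw [hs, ← map_mul, ← this, hφ, Unitary.conjStarAlgAut_apply, Matrix.trace_mul_comm,
      ← mul_assoc]
    simp

theorem aux_charpoly {V : Type} [Fintype V] [DecidableEq V] (G : SimpleGraph V)
    [DecidableRel G.Adj] (S T : Finset V) (hd : Disjoint S T)
    (hadj : ∀ x y, G.Adj x y ↔ (x ∈ S ∧ y ∈ T) ∨ (x ∈ T ∧ y ∈ S))
    (hV : 2 ≤ Fintype.card V) :
    (G.adjMatrix ℝ).charpoly =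
      X ^ (Fintype.card V - 2) * (X ^ 2 - C (((S.card * T.card : ℕ) : ℝ))) := by
  let f : V → ℝ := fun x => if x ∈ S then 1 else 0
  let g : V → ℝ := fun x => if x ∈ T then 1 else 0
  let M : Matrix V (Fin 2) ℝ := Matrix.of fun x i => if i = 0 then f x else g x
  let N : Matrix (Fin 2) V ℝ := Matrix.of fun i x => if i = 0 then g x else f x
  have hST : ∀ x, x ∈ S → x ∉ T := fun x hx => Finset.disjoint_left.1 hd hx
  have hfac : G.adjMatrix ℝ = M * N := by
    ext x y
    have h1 := hST x
    have h2 := hST y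
    rw [Matrix.mul_apply, Fin.sum_univ_two, SimpleGraph.adjMatrix_apply]
    simp only [M, N, f, g, Matrix.of_apply, hadj]
    by_cases a1 : x ∈ S <;> by_cases a2 : x ∈ T <;> by_cases a3 : y ∈ S <;>
      by_cases a4 : y ∈ T <;> simp_all
  have hfg : ∀ x, f x * g x = 0 := by
    intro x
    have h1 := hST x
    simp only [f, g]
    by_cases a1 : x ∈ S <;> simp_all
  have hNM : N * M = !![0, (T.card : ℝ); (S.card : ℝ), 0] := by
    ext i j
    rw [Matrix.mul_apply]
    fin_cases i <;> fin_cases j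
    · simp [N, M, mul_comm (g _), hfg]
    · simp [N, M, g]
    · simp [N, M, f]
    · simp [N, M, hfg]
  rw [hfac, Matrix.charpoly_mul_comm_of_le M N (by simpa using hV), hNM, Fintype.card_fin]
  congr 1
  rw [Matrix.charpoly_fin_two]
  simp [Matrix.trace_fin_two, Matrix.det_fin_two]
  ring

theorem aux_comb {V : Type} [Fintype V] [DecidableEq V] (G : SimpleGraph V)
    [DecidableRel G.Adj] (m : ℕ) (hm : 0 < m)
    (h3 : G.adjMatrix ℝ * G.adjMatrix ℝ * G.adjMatrix ℝ = (m : ℝ) • G.adjMatrix ℝ)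
    (h2 : (G.adjMatrix ℝ * G.adjMatrix ℝ).trace = 2 * (m : ℝ)) :
    ∃ S T : Finset V, Disjoint S T ∧
      (∀ x y, G.Adj x y ↔ (x ∈ S ∧ y ∈ T) ∨ (x ∈ T ∧ y ∈ S)) ∧ S.card * T.card = m := by
  have hm' : (0 : ℝ) < m := by exact_mod_cast hm
  let A : V → V → ℝ := fun x y => if G.Adj x y then 1 else 0
  have hA0 : ∀ x y, 0 ≤ A x y := fun x y => by simp only [A]; split_ifs <;> norm_num
  have e3 : ∀ u v, ∑ z : V × V, A u z.1 * A z.1 z.2 * A z.2 v = m * A u v := by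
    intro u v
    have := congrFun (congrFun h3 u) v
    rw [Matrix.mul_apply] at this
    simp only [Matrix.mul_apply, Matrix.smul_apply, SimpleGraph.adjMatrix_apply,
      smul_eq_mul, Finset.sum_mul] at this
    rw [Fintype.sum_prod_type_right]
    exact this
  have e2 : ∑ z : V × V, A z.1 z.2 = 2 * m := by
    rw [← h2, Matrix.trace, Fintype.sum_prod_type]
    refine Finset.sum_congr rfl fun x _ => ?_
    rw [Matrix.diag_apply, Matrix.mul_apply]
    refine Finset.sum_congr rfl fun y _ => ?_
    simp [A, SimpleGraph.adjMatrix_apply, G.adj_comm y x]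
  have hwalk : ∀ u x y v, G.Adj u x → G.Adj x y → G.Adj y v → G.Adj u v := by
    intro u x y v h1 h2 h3
    by_contra hn
    have h := e3 u v
    have hz : A u v = 0 := by simp [A, hn]
    rw [hz, mul_zero, Finset.sum_eq_zero_iff_of_nonneg
      (fun z _ => mul_nonneg (mul_nonneg (hA0 _ _) (hA0 _ _)) (hA0 _ _))] at h
    have := h (x, y) (Finset.mem_univ _)
    simp [A, h1, h2, h3] at this
  have htri : ∀ x y z, G.Adj x y → G.Adj y z → ¬ G.Adj z x := by
    intro x y z h1 h2 h3
    exact G.loopless.irrefl x (hwalk x y z x h1 h2 h3)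
  obtain ⟨u, v, huv⟩ : ∃ u v, G.Adj u v := by
    by_contra hn
    push Not at hn
    have : ∑ z : V × V, A z.1 z.2 = 0 := Finset.sum_eq_zero fun z _ => by simp [A, hn]
    rw [e2] at this
    linarith
  have euv := e3 u v
  have hAuv : A u v = 1 := by simp [A, huv]
  rw [hAuv, mul_one] at euv
  have euv' : ∑ z : V × V, A u z.2 * A z.2 z.1 * A z.1 v = m := by
    rw [← euv]
    exact Fintype.sum_equiv (Equiv.prodComm V V) _ _ (fun z => rfl)
  have hle : ∀ z ∈ (Finset.univ : Finset (V × V)),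
      A u z.1 * A z.1 z.2 * A z.2 v + A u z.2 * A z.2 z.1 * A z.1 v ≤ A z.1 z.2 := by
    rintro ⟨x, y⟩ -
    have t1 := htri u x v
    have hvu := huv.symm
    have hc := G.adj_comm x y
    simp only [A]
    clear euv euv' e2 e3 h2 h3 hwalk htri
    by_cases a1 : G.Adj u x <;> by_cases a2 : G.Adj x v <;> by_cases a3 : G.Adj x y <;>
      by_cases a4 : G.Adj u y <;> by_cases a5 : G.Adj y v <;> simp_all
  have heq := (Finset.sum_eq_sum_iff_of_le hle).1 (by
    rw [Finset.sum_add_distrib, euv, euv', e2]; ring)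
  refine ⟨Finset.univ.filter (G.Adj u), Finset.univ.filter (G.Adj v), ?_, ?_, ?_⟩
  · rw [Finset.disjoint_left]
    intro x hx hx'
    simp only [Finset.mem_filter, Finset.mem_univ, true_and] at hx hx'
    exact htri u x v hx hx'.symm huv.symm
  · intro x y
    simp only [Finset.mem_filter, Finset.mem_univ, true_and]
    constructor
    · intro hxy
      have h := heq (x, y) (Finset.mem_univ _)
      simp only [A, if_pos hxy, if_pos hxy.symm, mul_one] at h
      rw [G.adj_comm v x, G.adj_comm v y]
      clear heq hle euv euv' e2 e3 h2 h3 hwalk htri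
      by_cases a1 : G.Adj u x <;> by_cases a2 : G.Adj x v <;>
        by_cases a4 : G.Adj u y <;> by_cases a5 : G.Adj y v <;>
        first
        | exact Or.inl ⟨a1, a5⟩
        | exact Or.inr ⟨a2, a4⟩
        | (exfalso; simp [a1, a2, a4, a5] at h)
    · rintro (⟨h1, h2⟩ | ⟨h1, h2⟩)
      · exact hwalk x u v y h1.symm huv h2
      · exact hwalk x v u y h1.symm huv.symm h2
  · have : (∑ z : V × V, A u z.1 * A z.2 v) = m := by
      rw [← euv]
      refine Finset.sum_congr rfl ?_
      rintro ⟨x, y⟩ -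
      have h1 := hwalk x u v y
      have hc := G.adj_comm x u
      have hc3 := G.adj_comm v y
      simp only [A]
      clear heq hle euv euv' e2 e3 h2 h3 hwalk htri
      by_cases a1 : G.Adj u x <;> by_cases a5 : G.Adj y v <;> simp_all
    rw [Fintype.sum_prod_type] at this
    simp only [← Finset.mul_sum, ← Finset.sum_mul] at this
    simp only [A, Finset.sum_boole, G.adj_comm _ v] at this
    exact_mod_cast this

theorem aux_iso {V : Type} [Fintype V] [DecidableEq V] (G : SimpleGraph V)
    (S T : Finset V) (hd : Disjoint S T)
    (hadj : ∀ x y, G.Adj x y ↔ (x ∈ S ∧ y ∈ T) ∨ (x ∈ T ∧ y ∈ S))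
    (p q : ℕ) (hS : S.card = p) (hT : T.card = q) (hV : Fintype.card V = p + q) :
    Nonempty (G ≃g completeBipartiteGraph (Fin p) (Fin q)) := by
  have hun : ∀ x, x ∈ S ∨ x ∈ T := by
    have : S ∪ T = Finset.univ := by
      rw [← Finset.card_eq_iff_eq_univ, Finset.card_union_of_disjoint hd, hS, hT, hV]
    intro x
    rw [← Finset.mem_union, this]
    exact Finset.mem_univ x
  let eS : Fin p ≃ S := (Fintype.equivFinOfCardEq (by simpa using hS)).symm
  let eT : Fin q ≃ T := (Fintype.equivFinOfCardEq (by simpa using hT)).symm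
  let f : Fin p ⊕ Fin q → V := Sum.elim (fun i => (eS i : V)) (fun i => (eT i : V))
  have hST : ∀ x, x ∈ S → x ∉ T := fun x hx => Finset.disjoint_left.1 hd hx
  have hf : Function.Bijective f := by
    constructor
    · apply Function.Injective.sumElim
      · exact Subtype.val_injective.comp eS.injective
      · exact Subtype.val_injective.comp eT.injective
      · intro i j hij
        exact hST _ (eS i).2 (hij ▸ (eT j).2)
    · intro x
      rcases hun x with h | h
      · exact ⟨Sum.inl (eS.symm ⟨x, h⟩), by simp [f]⟩
      · exact ⟨Sum.inr (eT.symm ⟨x, h⟩), by simp [f]⟩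
  refine ⟨(RelIso.symm ⟨Equiv.ofBijective f hf, ?_⟩)⟩
  have hTS : ∀ x, x ∈ T → x ∉ S := fun x h h' => hST x h' h
  rintro (i | i) (j | j)
  · simp [f, hadj, hST]
  · simp [f, hadj]
  · simp [f, hadj]
  · simp [f, hadj, hTS]

theorem completeBipartiteGraph_DS_iff_AM_minimizer (p q : ℕ) (hp : 1 ≤ p) (hq : 1 ≤ q) :
    (∀ (V : Type) (_ : Fintype V) (_ : DecidableEq V) (H : SimpleGraph V)
      (_ : DecidableRel H.Adj),
      (H.adjMatrix ℝ).charpoly =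
          ((completeBipartiteGraph (Fin p) (Fin q)).adjMatrix ℝ).charpoly →
        Nonempty (H ≃g completeBipartiteGraph (Fin p) (Fin q))) ↔
    (∀ a b : ℕ, 1 ≤ a → 1 ≤ b → a * b = p * q → p + q ≤ a + b) := by
  have hK := aux_charpoly (completeBipartiteGraph (Fin p) (Fin q))
    (Finset.univ.map Function.Embedding.inl) (Finset.univ.map Function.Embedding.inr)
    (by
      rw [Finset.disjoint_left]
      rintro (i | i) <;> simp)
    (by rintro (i | i) (j | j) <;> simp) (by simp; omega)
  simp only [Finset.card_map, Finset.card_univ, Fintype.card_fin, Fintype.card_sum] at hK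
  constructor
  · intro h a b ha hb hab
    by_contra hlt
    push Not at hlt
    classical
    let S : Finset (Fin (p + q)) := Finset.univ.filter fun i => i.val < a
    let T : Finset (Fin (p + q)) := Finset.univ.filter fun i => a ≤ i.val ∧ i.val < a + b
    have hS : S.card = a := by
      have : S = Finset.Iio (⟨a, by omega⟩ : Fin (p + q)) := by
        ext i; simp [S, Fin.lt_def]
      rw [this, Fin.card_Iio]
    have hT : T.card = b := by
      have : T = Finset.Ico (⟨a, by omega⟩ : Fin (p + q)) ⟨a + b, hlt⟩ := by
        ext i; simp [T, Fin.lt_def, Fin.le_def]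
      rw [this, Fin.card_Ico]
      simp
    have hd : Disjoint S T := by
      rw [Finset.disjoint_left]
      intro i
      simp only [S, T, Finset.mem_filter, Finset.mem_univ, true_and]
      omega
    let G : SimpleGraph (Fin (p + q)) :=
      { Adj := fun x y => (x ∈ S ∧ y ∈ T) ∨ (x ∈ T ∧ y ∈ S)
        symm := ⟨fun x y h => by tauto⟩
        loopless := ⟨fun x h => by
          have : x ∈ S → x ∉ T := fun hx => Finset.disjoint_left.1 hd hx
          tauto⟩ }
    have hG := aux_charpoly G S T hd (fun x y => Iff.rfl) (by simp; omega)
    rw [hS, hT, hab, Fintype.card_fin, ← hK] at hG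
    obtain ⟨e⟩ := h _ _ _ G _ hG
    let x : Fin (p + q) := ⟨a + b, hlt⟩
    have hx : ∀ y, ¬ G.Adj x y := by
      intro y hy
      have hy' : (x ∈ S ∧ y ∈ T) ∨ (x ∈ T ∧ y ∈ S) := hy
      simp [S, T, x] at hy'
    obtain ⟨w, hw⟩ : ∃ w, (completeBipartiteGraph (Fin p) (Fin q)).Adj (e x) w := by
      rcases e x with i | i
      · exact ⟨Sum.inr ⟨0, hq⟩, by simp⟩
      · exact ⟨Sum.inl ⟨0, hp⟩, by simp⟩
    apply hx (e.symm w)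
    rw [← e.map_adj_iff]
    simpa using hw
  · intro h V _ _ H _ hH
    have hcard : Fintype.card V = p + q := by
      have := congrArg natDegree hH
      simpa [Matrix.charpoly_natDegree_eq_dim] using this
    rw [hK] at hH
    have hherm : (H.adjMatrix ℝ).IsHermitian := by
      rw [Matrix.IsHermitian, Matrix.conjTranspose_eq_transpose_of_trivial]
      exact H.transpose_adjMatrix
    obtain ⟨h3, h2⟩ := aux_spec _ hherm _ _ (by positivity) hH
    have hpq : 0 < p * q := Nat.mul_pos hp hq
    obtain ⟨S, T, hd, hadj, hm⟩ := aux_comb H (p * q) hpq h3 h2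
    have hSpos : 0 < S.card := Nat.pos_of_ne_zero fun h0 => by simp [h0] at hm; omega
    have hTpos : 0 < T.card := Nat.pos_of_ne_zero fun h0 => by simp [h0] at hm; omega
    have hge := h _ _ hSpos hTpos hm
    have hle : S.card + T.card ≤ p + q := by
      rw [← hcard, ← Finset.card_union_of_disjoint hd]
      exact Finset.card_le_univ _
    have hsum : S.card + T.card = p + q := le_antisymm hle hge
    have hor : S.card = p ∨ S.card = q := by
      have : ((S.card : ℤ) - p) * (S.card - q) = 0 := by
        have e1 : (S.card : ℤ) + T.card = p + q := by exact_mod_cast hsum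
        have e2 : (S.card : ℤ) * T.card = p * q := by exact_mod_cast hm
        linear_combination (S.card : ℤ) * e1 - e2
      rcases mul_eq_zero.1 this with h | h
      · left; omega
      · right; omega
    rcases hor with h1 | h1
    · exact aux_iso H S T hd hadj p q h1 (by omega) hcard
    · exact aux_iso H T S hd.symm (fun x y => by rw [hadj]; tauto) p q (by omega) h1 hcard
end

section
/- Let 1 ≤ k ≤ n and let G be a finite simple graph whose adjacency matrix has the same characteristic polynomial (over ℝ) as that of the Turán graph T(n,k). Then G contains no clique of order k+1, i.e., G is K_{k+1}-free (Mathlib: G.CliqueFree (k+1)). -/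
open Polynomial

/-- Diagonalization of the quadratic form of a real symmetric matrix. -/
lemma exists_diag {V : Type} [Fintype V] [DecidableEq V] {A : Matrix V V ℝ}
    (hA : A.IsHermitian) : ∃ U : Matrix V V ℝ, U.transpose * U = 1 ∧ U * U.transpose = 1 ∧
      ∀ x : V → ℝ, x ⬝ᵥ A.mulVec x = ∑ i, hA.eigenvalues i * (U.transpose.mulVec x i) ^ 2 := by
  refine ⟨hA.eigenvectorUnitary, ?_, ?_, ?_⟩
  · have := Unitary.coe_star_mul_self hA.eigenvectorUnitary
    simpa [Matrix.star_eq_conjTranspose] using this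
  · have := Unitary.coe_mul_star_self hA.eigenvectorUnitary
    simpa [Matrix.star_eq_conjTranspose] using this
  · intro x
    have hs := hA.spectral_theorem
    rw [Unitary.conjStarAlgAut_apply] at hs
    set U : Matrix V V ℝ := (hA.eigenvectorUnitary : Matrix V V ℝ) with hU
    have h2 : A = U * Matrix.diagonal hA.eigenvalues * U.transpose := by
      simpa [Matrix.star_eq_conjTranspose, Function.comp_def] using hs
    conv_lhs => rw [h2]
    rw [← Matrix.mulVec_mulVec, ← Matrix.mulVec_mulVec, Matrix.dotProduct_mulVec,
      ← Matrix.mulVec_transpose]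
    simp only [dotProduct, Matrix.mulVec_diagonal]
    exact Finset.sum_congr rfl fun i _ => by ring

lemma card_le_neg {V ι : Type} [Fintype V] [DecidableEq V] [Fintype ι] {A : Matrix V V ℝ}
    (hA : A.IsHermitian) (f : (ι → ℝ) →ₗ[ℝ] (V → ℝ)) (g : (ι → ℝ) →ₗ[ℝ] ℝ)
    (hf : ∀ y, y ≠ 0 → g y = 0 → f y ⬝ᵥ A.mulVec (f y) < 0) :
    Fintype.card ι ≤ Fintype.card {i // hA.eigenvalues i < 0} + 1 := by
  obtain ⟨U, -, -, hU⟩ := exists_diag hA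
  let F : (ι → ℝ) →ₗ[ℝ] ({i // hA.eigenvalues i < 0} → ℝ) × ℝ :=
    ((LinearMap.funLeft ℝ ℝ Subtype.val) ∘ₗ U.transpose.mulVecLin ∘ₗ f).prod g
  have hF : Function.Injective F := by
    rw [injective_iff_map_eq_zero]
    intro y hy
    by_contra hne
    have h1 : ∀ i, hA.eigenvalues i < 0 → U.transpose.mulVec (f y) i = 0 := fun i hi =>
      congrFun (congrArg Prod.fst hy) ⟨i, hi⟩
    have h2 : g y = 0 := congrArg Prod.snd hy
    have h3 := hf y hne h2
    rw [hU] at h3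
    refine absurd h3 (not_lt.2 (Finset.sum_nonneg fun i _ => ?_))
    by_cases hi : hA.eigenvalues i < 0
    · simp [h1 i hi]
    · exact mul_nonneg (not_lt.1 hi) (sq_nonneg _)
  simpa using LinearMap.finrank_le_finrank_of_injective hF

lemma neg_le_card {V κ : Type} [Fintype V] [DecidableEq V] [Fintype κ] {A : Matrix V V ℝ}
    (hA : A.IsHermitian) (L : (V → ℝ) →ₗ[ℝ] (κ → ℝ))
    (hL : ∀ x, L x = 0 → 0 ≤ x ⬝ᵥ A.mulVec x) :
    Fintype.card {i // hA.eigenvalues i < 0} ≤ Fintype.card κ := by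
  obtain ⟨U, hU1, -, hU⟩ := exists_diag hA
  let E : ({i // hA.eigenvalues i < 0} → ℝ) →ₗ[ℝ] (V → ℝ) :=
    Function.ExtendByZero.linearMap ℝ Subtype.val
  have hE1 : ∀ z i, E z (i : {i // hA.eigenvalues i < 0}).1 = z i := fun z i =>
    Subtype.val_injective.extend_apply z 0 i
  have hE2 : ∀ z i, ¬ hA.eigenvalues i < 0 → E z i = 0 := fun z i hi =>
    Function.extend_apply' _ _ _ (by rintro ⟨a, rfl⟩; exact hi a.2)
  have hF : Function.Injective (L ∘ₗ U.mulVecLin ∘ₗ E) := by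
    rw [injective_iff_map_eq_zero]
    intro z hz
    have h1 := hL (U.mulVec (E z)) hz
    rw [hU, Matrix.mulVec_mulVec, hU1, Matrix.one_mulVec] at h1
    have h2 : ∀ i ∈ Finset.univ, hA.eigenvalues i * E z i ^ 2 ≤ 0 := by
      intro i _
      by_cases hi : hA.eigenvalues i < 0
      · exact mul_nonpos_of_nonpos_of_nonneg hi.le (sq_nonneg _)
      · simp [hE2 z i hi]
    have h3 := (Finset.sum_eq_zero_iff_of_nonpos h2).1 (le_antisymm (Finset.sum_nonpos h2) h1)
    funext i
    have h4 := h3 i.1 (Finset.mem_univ _)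
    rw [hE1] at h4
    simpa [i.2.ne] using h4
  simpa using LinearMap.finrank_le_finrank_of_injective hF

lemma card_neg_eq {V W : Type} [Fintype V] [DecidableEq V] [Fintype W] [DecidableEq W]
    {A : Matrix V V ℝ} {B : Matrix W W ℝ} (hA : A.IsHermitian) (hB : B.IsHermitian)
    (h : A.charpoly = B.charpoly) :
    Fintype.card {i // hA.eigenvalues i < 0} = Fintype.card {i // hB.eigenvalues i < 0} := by
  have h1 := hA.roots_charpoly_eq_eigenvalues
  rw [h, hB.roots_charpoly_eq_eigenvalues] at h1
  have h2 := congrArg (Multiset.countP (fun x : ℝ => x < 0)) h1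
  rw [Multiset.countP_map, Multiset.countP_map] at h2
  rw [Fintype.card_subtype, Fintype.card_subtype]
  exact h2.symm

lemma turan_form (n k : ℕ) (hk : 1 ≤ k) (x : Fin n → ℝ) (s : ℝ)
    (hs : ∀ c < k, ∑ v with v.1 % k = c, x v = s) :
    0 ≤ x ⬝ᵥ ((SimpleGraph.turanGraph n k).adjMatrix ℝ).mulVec x := by
  have htot : ∑ v, x v = k * s := by
    rw [← Finset.sum_fiberwise_of_maps_to (s := Finset.univ) (t := Finset.range k)
      (g := fun v : Fin n => v.1 % k) (fun v _ => Finset.mem_range.2 (Nat.mod_lt _ hk))]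
    rw [Finset.sum_congr rfl fun c hc => hs c (Finset.mem_range.1 hc)]
    simp
  have h1 : ∀ v, ((SimpleGraph.turanGraph n k).adjMatrix ℝ).mulVec x v = k * s - s := by
    intro v
    rw [← htot]
    conv_rhs => rw [← hs _ (Nat.mod_lt v.1 hk)]
    rw [Finset.sum_filter, ← Finset.sum_sub_distrib]
    simp only [Matrix.mulVec, dotProduct, SimpleGraph.adjMatrix_apply, SimpleGraph.turanGraph_adj]
    refine Finset.sum_congr rfl fun w _ => ?_
    by_cases hw : w.1 % k = v.1 % k
    · simp [hw]
    · simp [hw, Ne.symm hw]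
  simp only [dotProduct, h1]
  rw [← Finset.sum_mul, htot]
  have hk' : (1 : ℝ) ≤ k := by exact_mod_cast hk
  have : (k : ℝ) * s * (k * s - s) = k * (k - 1) * s ^ 2 := by ring
  rw [this]
  exact mul_nonneg (mul_nonneg (by linarith) (by linarith)) (sq_nonneg _)

lemma clique_form {V : Type} [Fintype V] [DecidableEq V] (G : SimpleGraph V) [DecidableRel G.Adj]
    (s : Finset V) (hs : G.IsClique s) (x : V → ℝ) (hx : ∀ v ∉ s, x v = 0)
    (h0 : ∑ v, x v = 0) (hne : x ≠ 0) : x ⬝ᵥ (G.adjMatrix ℝ).mulVec x < 0 := by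
  have h1 : ∀ v, x v * (G.adjMatrix ℝ).mulVec x v = - x v ^ 2 := by
    intro v
    by_cases hv : v ∈ s
    · have : (G.adjMatrix ℝ).mulVec x v = ∑ w, x w - ∑ w, if w = v then x w else 0 := by
        rw [← Finset.sum_sub_distrib]
        simp only [Matrix.mulVec, dotProduct, SimpleGraph.adjMatrix_apply]
        refine Finset.sum_congr rfl fun w _ => ?_
        by_cases hw : w = v
        · simp [hw]
        · by_cases hws : w ∈ s
          · simp [hw, hs hv hws (Ne.symm hw)]
          · simp [hx w hws]
      rw [this, h0]
      simp
      ring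
    · simp [hx v hv]
  simp only [dotProduct, h1]
  obtain ⟨v, hv⟩ := Function.ne_iff.1 hne
  rw [Finset.sum_neg_distrib, neg_lt_zero]
  exact Finset.sum_pos' (fun i _ => sq_nonneg _) ⟨v, Finset.mem_univ _, by
    have : x v ≠ 0 := hv
    positivity⟩

/-- Every finite simple graph `A`-cospectral with the Turán graph `T(n,k)` contains no
clique of order `k + 1`. -/
theorem cliqueFree_of_cospectral_turanGraph (n k : ℕ) (hk : 1 ≤ k) (hkn : k ≤ n)
    {V : Type} [Fintype V] [DecidableEq V] (G : SimpleGraph V) [DecidableRel G.Adj]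
    (h : (G.adjMatrix ℝ).charpoly = ((SimpleGraph.turanGraph n k).adjMatrix ℝ).charpoly) :
    G.CliqueFree (k + 1) := by
  intro s hs
  have hA : (G.adjMatrix ℝ).IsHermitian := by
    rw [Matrix.IsHermitian, Matrix.conjTranspose_eq_transpose_of_trivial,
      SimpleGraph.transpose_adjMatrix]
  have hB : ((SimpleGraph.turanGraph n k).adjMatrix ℝ).IsHermitian := by
    rw [Matrix.IsHermitian, Matrix.conjTranspose_eq_transpose_of_trivial,
      SimpleGraph.transpose_adjMatrix]
  have h1 := card_neg_eq hA hB h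
  let P : ℕ → (Fin n → ℝ) →ₗ[ℝ] ℝ := fun c =>
    ∑ v with v.1 % k = c, LinearMap.proj v
  have hP : ∀ c x, P c x = ∑ v with v.1 % k = c, x v := fun c x => by
    simp [P, LinearMap.sum_apply]
  have h2 := neg_le_card hB (κ := Fin (k - 1))
    (LinearMap.pi fun c => P c.1 - P (k - 1)) (by
      intro x hx
      refine turan_form n k hk x (P (k - 1) x) fun c hc => ?_
      rw [← hP]
      by_cases hck : c = k - 1
      · rw [hck]
      · have := congrFun hx ⟨c, by omega⟩
        simpa [sub_eq_zero] using this)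
  let E : (s → ℝ) →ₗ[ℝ] (V → ℝ) := Function.ExtendByZero.linearMap ℝ Subtype.val
  have hE1 : ∀ z (i : s), E z i.1 = z i := fun z i =>
    Subtype.val_injective.extend_apply z 0 i
  have hE2 : ∀ z, ∀ i ∉ s, E z i = 0 := fun z i hi =>
    Function.extend_apply' _ _ _ (by rintro ⟨a, rfl⟩; exact hi a.2)
  have h3 := card_le_neg hA E ((∑ v : V, LinearMap.proj v) ∘ₗ E) (by
    intro y hy hg
    refine clique_form G s hs.1 (E y) (hE2 y) ?_ ?_
    · simpa [LinearMap.sum_apply] using hg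
    · intro h0
      apply hy
      funext i
      rw [← hE1 y i, h0]
      rfl)
  have h4 := hs.2
  simp only [Fintype.card_coe, Fintype.card_fin] at h2 h3
  omega
end

section
/- Let 1 ≤ k ≤ n and let G be a finite simple graph whose adjacency matrix has the same characteristic polynomial (over ℝ) as that of the Turán graph T(n,k). Then G is a complete k-partite graph: there exists a surjective function f from the vertex set of G onto Fin k such that two vertices u, v are adjacent in G if and only if f(u) ≠ f(v). -/
open Polynomial

/-- Real symmetric matrices with the same characteristic polynomial are orthogonally similar. -/
theorem exists_orthogonal_similarity {n : ℕ} (A B : Matrix (Fin n) (Fin n) ℝ)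
    (hA : A.IsHermitian) (hB : B.IsHermitian) (h : A.charpoly = B.charpoly) :
    ∃ P : Matrix (Fin n) (Fin n) ℝ, P.transpose * P = 1 ∧ A = P * B * P.transpose := by
  have he := (Matrix.IsHermitian.eigenvalues_eq_eigenvalues_iff hA hB).2 h
  have h1 := hA.spectral_theorem
  have h2 := hB.spectral_theorem
  rw [Unitary.conjStarAlgAut_apply] at h1 h2
  rw [he] at h1
  set D := Matrix.diagonal ((RCLike.ofReal : ℝ → ℝ) ∘ hB.eigenvalues)
  clear_value D
  generalize hA.eigenvectorUnitary = U₀ at h1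
  generalize hB.eigenvectorUnitary = W₀ at h2
  obtain ⟨U, hU⟩ := U₀
  obtain ⟨W, hW⟩ := W₀
  have hU' := Unitary.star_mul_self_of_mem hU
  have hW' := Unitary.star_mul_self_of_mem hW
  have hW'' := Unitary.mul_star_self_of_mem hW
  simp only [Matrix.star_eq_conjTranspose, Matrix.conjTranspose_eq_transpose_of_trivial] at *
  refine ⟨U * W.transpose, ?_, ?_⟩
  · rw [Matrix.transpose_mul, Matrix.transpose_transpose]
    calc W * U.transpose * (U * W.transpose) = W * (U.transpose * U) * W.transpose := by
          simp only [Matrix.mul_assoc]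
      _ = 1 := by rw [hU', Matrix.mul_one, hW'']
  · rw [h1, h2, Matrix.transpose_mul, Matrix.transpose_transpose]
    calc U * D * U.transpose = U * 1 * D * 1 * U.transpose := by simp
      _ = U * (W.transpose * W) * D * (W.transpose * W) * U.transpose := by rw [hW']
      _ = _ := by simp only [Matrix.mul_assoc]

theorem top_form {m : ℕ} (c : Fin m → ℝ) :
    c ⬝ᵥ (((⊤ : SimpleGraph (Fin m)).adjMatrix ℝ).mulVec c) = (∑ i, c i) ^ 2 - ∑ i, c i ^ 2 := by
  have : ((⊤ : SimpleGraph (Fin m)).adjMatrix ℝ).mulVec c = fun i => ∑ j, c j - c i := by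
    funext i
    simp [Matrix.mulVec, dotProduct, SimpleGraph.adjMatrix_apply, Finset.sum_ite, Finset.filter_ne,
      ← Finset.sum_erase_eq_sub]
  rw [this]
  simp only [dotProduct, mul_sub, Finset.sum_sub_distrib, ← Finset.sum_mul, sq]

theorem form_conj {m n : Type} [Fintype m] [Fintype n] (M : Matrix m n ℝ) (A : Matrix m m ℝ)
    (c : n → ℝ) :
    c ⬝ᵥ ((M.transpose * A * M).mulVec c) = (M.mulVec c) ⬝ᵥ (A.mulVec (M.mulVec c)) := by
  rw [← Matrix.mulVec_mulVec, ← Matrix.mulVec_mulVec, Matrix.dotProduct_mulVec,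
    Matrix.vecMul_transpose]

theorem submatrix_factor {m n : Type} [Fintype m] [DecidableEq m] [Fintype n]
    (A : Matrix m m ℝ) (f : n → m) :
    A.submatrix f f = ((1 : Matrix m m ℝ).submatrix id f).transpose * A *
      (1 : Matrix m m ℝ).submatrix id f := by
  ext i j
  simp [Matrix.mul_apply, Matrix.one_apply]

theorem turan_factor (n k : ℕ) [NeZero k] :
    ∃ S : Matrix (Fin k) (Fin n) ℝ, (SimpleGraph.turanGraph n k).adjMatrix ℝ =
      S.transpose * (⊤ : SimpleGraph (Fin k)).adjMatrix ℝ * S := by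
  refine ⟨(1 : Matrix (Fin k) (Fin k) ℝ).submatrix id fun v : Fin n => Fin.ofNat k v.val, ?_⟩
  rw [← submatrix_factor]
  ext u v
  simp [SimpleGraph.adjMatrix_apply, SimpleGraph.turanGraph_adj, Fin.ext_iff]

theorem cliqueFree_of_cospectral (n k : ℕ) [NeZero k] (G : SimpleGraph (Fin n))
    [DecidableRel G.Adj] (P : Matrix (Fin n) (Fin n) ℝ)
    (hP : G.adjMatrix ℝ = P * (SimpleGraph.turanGraph n k).adjMatrix ℝ * P.transpose) :
    G.CliqueFree (k + 1) := by
  by_contra hc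
  let φ := SimpleGraph.topEmbeddingOfNotCliqueFree hc
  obtain ⟨S, hS⟩ := turan_factor n k
  let M : Matrix (Fin n) (Fin (k + 1)) ℝ := (1 : Matrix (Fin n) (Fin n) ℝ).submatrix id φ
  have hM : (⊤ : SimpleGraph (Fin (k + 1))).adjMatrix ℝ = M.transpose * G.adjMatrix ℝ * M := by
    rw [← submatrix_factor]
    ext i j
    have : (⊤ : SimpleGraph (Fin (k + 1))).Adj i j ↔ G.Adj (φ i) (φ j) := φ.map_rel_iff.symm
    simp only [SimpleGraph.adjMatrix_apply, Matrix.submatrix_apply, this]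
  let R : Matrix (Fin k) (Fin (k + 1)) ℝ := S * P.transpose * M
  have hR : (⊤ : SimpleGraph (Fin (k + 1))).adjMatrix ℝ =
      R.transpose * (⊤ : SimpleGraph (Fin k)).adjMatrix ℝ * R := by
    rw [hM, hP, hS]
    simp only [R, Matrix.transpose_mul, Matrix.transpose_transpose, Matrix.mul_assoc]
  let N : Matrix (Fin k) (Fin (k + 1)) ℝ :=
    Matrix.of fun i j => if i = 0 then 1 else R i j - R 0 j
  have hker : LinearMap.ker N.mulVecLin ≠ ⊥ := LinearMap.ker_ne_bot_of_finrank_lt (by simp)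
  obtain ⟨c, hcN, hc0⟩ := Submodule.exists_mem_ne_zero_of_ne_bot hker
  have hN : ∀ i, N.mulVec c i = 0 := fun i => congrFun (LinearMap.mem_ker.1 hcN) i
  have hsum : ∑ i, c i = 0 := by
    have := hN 0
    simpa [N, Matrix.mulVec, dotProduct] using this
  have hconst : ∀ i, R.mulVec c i = R.mulVec c 0 := by
    intro i
    by_cases hi : i = 0
    · rw [hi]
    · have := hN i
      simp only [N, Matrix.mulVec, dotProduct, Matrix.of_apply, hi, if_false, sub_mul,
        Finset.sum_sub_distrib] at this
      simpa [Matrix.mulVec, dotProduct] using sub_eq_zero.1 this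
  have e1 := top_form c
  rw [hR, form_conj, top_form, hsum] at e1
  simp only [hconst, Finset.sum_const, Finset.card_univ, Fintype.card_fin, nsmul_eq_mul] at e1
  have hk1 : (1 : ℝ) ≤ k := by exact_mod_cast NeZero.one_le
  have hpos : 0 < ∑ i, c i ^ 2 := by
    obtain ⟨j, hj⟩ := Function.ne_iff.1 hc0
    exact Finset.sum_pos' (fun i _ => sq_nonneg _) ⟨j, Finset.mem_univ _, by
      have : c j ≠ 0 := hj
      positivity⟩
  nlinarith [mul_nonneg (mul_nonneg (by linarith : (0:ℝ) ≤ k) (sub_nonneg.2 hk1))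
    (sq_nonneg (R.mulVec c 0))]

theorem trace_sq_adj {n : ℕ} (G : SimpleGraph (Fin n)) [DecidableRel G.Adj] :
    (G.adjMatrix ℝ * G.adjMatrix ℝ).trace = 2 * (G.edgeFinset.card : ℝ) := by
  simp only [Matrix.trace, Matrix.diag, SimpleGraph.adjMatrix_mul_self_apply_self]
  exact_mod_cast G.sum_degrees_eq_twice_card_edges

theorem iso_of_cospectral (n k : ℕ) [NeZero k] (G : SimpleGraph (Fin n))
    [DecidableRel G.Adj]
    (h : (G.adjMatrix ℝ).charpoly = ((SimpleGraph.turanGraph n k).adjMatrix ℝ).charpoly) :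
    Nonempty (G ≃g SimpleGraph.turanGraph n k) := by
  have herm : ∀ (H : SimpleGraph (Fin n)) [DecidableRel H.Adj], (H.adjMatrix ℝ).IsHermitian := by
    intro H _
    rw [Matrix.IsHermitian, Matrix.conjTranspose_eq_transpose_of_trivial,
      SimpleGraph.transpose_adjMatrix]
  obtain ⟨P, hP1, hP⟩ := exists_orthogonal_similarity _ _ (herm G) (herm _) h
  have hcf := cliqueFree_of_cospectral n k G P hP
  have hE : G.edgeFinset.card = (SimpleGraph.turanGraph n k).edgeFinset.card := by
    have h1 := trace_sq_adj G
    have h2 := trace_sq_adj (SimpleGraph.turanGraph n k)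
    have h3 : (G.adjMatrix ℝ * G.adjMatrix ℝ).trace = ((SimpleGraph.turanGraph n k).adjMatrix ℝ *
        (SimpleGraph.turanGraph n k).adjMatrix ℝ).trace := by
      rw [hP]
      generalize (SimpleGraph.turanGraph n k).adjMatrix ℝ = B
      calc (P * B * P.transpose * (P * B * P.transpose)).trace
          = (P * (B * (P.transpose * P) * B * P.transpose)).trace := by
            simp only [Matrix.mul_assoc]
        _ = (B * B * (P.transpose * P)).trace := by
            rw [Matrix.trace_mul_comm, hP1, Matrix.mul_one, Matrix.mul_assoc, hP1]
        _ = _ := by rw [hP1, Matrix.mul_one]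
    rw [h1, h2] at h3
    exact_mod_cast mul_left_cancel₀ two_ne_zero h3
  have hk : 0 < k := NeZero.pos k
  have hT := SimpleGraph.isTuranMaximal_turanGraph (n := n) hk
  have hG : G.IsTuranMaximal k := by
    refine ⟨hcf, fun H _ hH => ?_⟩
    rw [hE]
    exact hT.2 hH
  have hfin := hG.nonempty_iso_turanGraph
  rwa [Fintype.card_fin] at hfin

/-- Every finite simple graph `A`-cospectral with the Turán graph `T(n,k)` is a complete
`k`-partite graph: there is a surjection `f` onto `Fin k` such that two vertices are
adjacent iff their images under `f` differ. -/
theorem completeMultipartite_of_cospectral_turanGraph (n k : ℕ) (hk : 1 ≤ k) (hkn : k ≤ n)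
    {V : Type} [Fintype V] [DecidableEq V] (G : SimpleGraph V) [DecidableRel G.Adj]
    (h : (G.adjMatrix ℝ).charpoly = ((SimpleGraph.turanGraph n k).adjMatrix ℝ).charpoly) :
    ∃ f : V → Fin k, Function.Surjective f ∧ ∀ u v : V, G.Adj u v ↔ f u ≠ f v := by
  have : NeZero k := ⟨by omega⟩
  have hcard : Fintype.card V = n := by
    have := congrArg Polynomial.natDegree h
    simpa [Matrix.charpoly_natDegree_eq_dim] using this
  let e : V ≃ Fin n := Fintype.equivFinOfCardEq hcard
  let H : SimpleGraph (Fin n) := G.comap e.symm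
  have : DecidableRel H.Adj := Classical.decRel _
  have hH : H.adjMatrix ℝ = Matrix.reindex e e (G.adjMatrix ℝ) := by
    ext i j
    simp [SimpleGraph.adjMatrix_apply, H]
  obtain ⟨g⟩ := iso_of_cospectral n k H (by rw [hH, Matrix.charpoly_reindex, h])
  refine ⟨fun v => Fin.ofNat k (g (e v)).val, ?_, ?_⟩
  · intro i
    refine ⟨e.symm (g.symm ⟨i.val, by omega⟩), ?_⟩
    ext
    simp
  · intro u v
    have h1 : G.Adj u v ↔ H.Adj (e u) (e v) := by simp [H]
    rw [h1, ← g.map_adj_iff, SimpleGraph.turanGraph_adj]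
    simp [Fin.ext_iff]
end
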